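/- arXiv:1812.02444 — 2 statements merged into one kernel-verified Lean document; each statement's English description precedes it below -/
import Mathlib

section
/- (Generalized Farkas characterization of SOS via interpolation data.) Let $p\in\mathcal{P}^n_{\mathbb{K},+}[\mathbf{X}]$, $(\mathbf{x}_r)_{1\leq r\leq r_*}$ a unisolvent set of points in $\mathbb{K}$, $y_r = p(\mathbf{x}_r)$, and $B_r$ the associated localizing matrices. The following are equivalent: (i) $\langle\lambda, y\rangle \geq 0$ for every $\lambda$ in the cone $C_\infty = \{\lambda : \sum_r\lambda_r B_r \succeq 0\}$; (ii) there exist polynomials $q_{ij}$, $1\leq i\leq r_*$, $1\leq j\leq j_*$, with $\deg q_{ij}\leq n_j$, such that $p = \sum_{j=1}^{j_*} g_j \sum_{i=1}^{r_*} q_{ij}^2$. -/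
open MvPolynomial Matrix BigOperators

/-- Multi-indices `α` with `|α| ≤ m`, each component bounded by `m`. -/
def MIdx (d m : ℕ) : Type := {α : Fin d → Fin (m + 1) // ∑ i, ((α i : ℕ)) ≤ m}

noncomputable instance (d m : ℕ) : Fintype (MIdx d m) := Subtype.fintype _
instance (d m : ℕ) : DecidableEq (MIdx d m) := Subtype.instDecidableEq

/-- The monomial `X^α` associated with a multi-index. -/
noncomputable def monIdx {d m : ℕ} (α : MIdx d m) : MvPolynomial (Fin d) ℝ :=
  ∏ i, (X i) ^ ((α.1 i : ℕ))

/-- The block-diagonal polynomial-valued localizing matrix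
`B(X) = diag (g_1(X) D^{n_1}(X), …, g_{j*}(X) D^{n_{j*}}(X))`,
with `D^{n_j}(X)_{αβ} = X^α X^β`. -/
noncomputable def BPoly {d js : ℕ} (g : Fin js → MvPolynomial (Fin d) ℝ)
    (nj : Fin js → ℕ) :
    Matrix ((j : Fin js) × MIdx d (nj j)) ((j : Fin js) × MIdx d (nj j))
      (MvPolynomial (Fin d) ℝ) :=
  fun p q => if p.1 = q.1 then g p.1 * monIdx p.2 * monIdx q.2 else 0

/-- Evaluation `B(x)` of the localizing matrix at a point. -/
noncomputable def BEval {d js : ℕ} (g : Fin js → MvPolynomial (Fin d) ℝ)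
    (nj : Fin js → ℕ) (x : Fin d → ℝ) :
    Matrix ((j : Fin js) × MIdx d (nj j)) ((j : Fin js) × MIdx d (nj j)) ℝ :=
  fun p q => eval x (BPoly g nj p q)
/-- The image of a closed convex cone under a linear map whose kernel meets the cone only at the
origin is closed. -/
theorem ProperCone.isClosed_image {E F : Type*} [NormedAddCommGroup E] [NormedSpace ℝ E]
    [FiniteDimensional ℝ E] [NormedAddCommGroup F] [NormedSpace ℝ F] [ProperSpace F]
    (K : ProperCone ℝ E) (f : E →L[ℝ] F) (hf : ∀ x ∈ K, f x = 0 → x = 0) :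
    IsClosed (f '' (K : Set E)) := by
  have : ProperSpace E := FiniteDimensional.proper ℝ E
  have hS : IsCompact (f '' ((K : Set E) ∩ Metric.sphere 0 1)) :=
    ((isCompact_sphere 0 1).inter_left K.isClosed).image f.continuous
  have h0 : (0 : F) ∉ f '' ((K : Set E) ∩ Metric.sphere 0 1) := by
    rintro ⟨x, ⟨hxK, hx⟩, hfx⟩
    simp [hf x hxK hfx] at hx
  obtain ⟨c, hc, hball⟩ := Metric.mem_nhds_iff.1 (hS.isClosed.isOpen_compl.mem_nhds h0)
  have hbound : ∀ x ∈ K, c * ‖x‖ ≤ ‖f x‖ := by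
    intro x hx
    rcases eq_or_ne x 0 with rfl | hx0
    · simp
    have hpos : 0 < ‖x‖ := norm_pos_iff.2 hx0
    by_contra! hlt
    refine hball (a := f (‖x‖⁻¹ • x)) ?_
      ⟨‖x‖⁻¹ • x, ⟨K.smul_mem hx (by positivity), ?_⟩, rfl⟩
    · rw [mem_ball_zero_iff, map_smul, norm_smul, norm_inv, norm_norm, inv_mul_lt_iff₀ hpos]
      linarith
    · simp [norm_smul, hpos.ne']
  have hproper : IsProperMap (fun x : (K : Set E) => f x) := by
    refine isProperMap_iff_tendsto_cocompact.2 ⟨by fun_prop, ?_⟩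
    refine tendsto_cocompact_of_tendsto_dist_comp_atTop 0 ?_
    have hnorm := (tendsto_norm_cocompact_atTop (E := E)).comp
      K.isClosed.isClosedEmbedding_subtypeVal.tendsto_cocompact
    refine Filter.tendsto_atTop_mono (fun x => ?_) (hnorm.const_mul_atTop hc)
    simpa using hbound x x.2
  have h := hproper.isClosedMap.isClosed_range
  rwa [Set.range_comp' f Subtype.val, Subtype.range_coe] at h

/-- A positive semidefinite matrix with range in a subspace `V` has the same diagonal as a sum of
`card n` squares of vectors of `V`. -/
theorem Matrix.PosSemidef.exists_diag_eq_sum_sq {n : Type*} [Fintype n] [DecidableEq n]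
    {G : Matrix n n ℝ} (hG : G.PosSemidef) (V : Submodule ℝ (n → ℝ)) (hV : ∀ w, G *ᵥ w ∈ V) :
    ∃ v : n → n → ℝ, (∀ i, v i ∈ V) ∧ ∀ r, G r r = ∑ i, v i r ^ 2 := by
  refine ⟨fun i => √(hG.1.eigenvalues i) • ⇑(hG.1.eigenvectorBasis i), fun i => ?_, fun r => ?_⟩
  · rcases eq_or_ne (hG.1.eigenvalues i) 0 with h | h
    · simp [h]
    · have := hV (hG.1.eigenvectorBasis i)
      rw [hG.1.mulVec_eigenvectorBasis] at this
      exact V.smul_mem _ ((V.smul_mem_iff h).1 this)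
  · conv_lhs => rw [hG.1.spectral_theorem]
    simp [Unitary.conjStarAlgAut_apply, Matrix.mul_apply, Matrix.diagonal_apply, mul_pow,
      Real.sq_sqrt (hG.eigenvalues_nonneg _)]
    refine Finset.sum_congr rfl fun i _ => by ring

/-- An entry of a positive semidefinite matrix vanishes if the diagonal entry in its row does. -/
theorem Matrix.PosSemidef.apply_eq_zero_of_diag_eq_zero {n : Type*} [Fintype n] [DecidableEq n]
    {G : Matrix n n ℝ} (hG : G.PosSemidef) {r : n} (hr : G r r = 0) (s : n) : G r s = 0 := by
  have h := (hG.dotProduct_mulVec_zero_iff (Pi.single r 1)).1 (by simp [hr])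
  have hs := congrFun h s
  rw [← hG.1.apply]
  simpa using hs

/-- Families of positive semidefinite matrices with ranges in prescribed subspaces. -/
noncomputable def gramCone {ι n : Type*} [Fintype n] (V : ι → Submodule ℝ (n → ℝ)) :
    ProperCone ℝ (ι → Matrix n n ℝ) where
  carrier := {G | ∀ j, (G j).PosSemidef ∧ ∀ w, G j *ᵥ w ∈ V j}
  zero_mem' := fun j => ⟨.zero, fun w => by simp⟩
  add_mem' := fun hG hH j => ⟨(hG j).1.add (hH j).1, fun w => by
    rw [Pi.add_apply, Matrix.add_mulVec]; exact add_mem ((hG j).2 w) ((hH j).2 w)⟩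
  smul_mem' := fun c G hG j => ⟨(hG j).1.smul c.2, fun w => by
    have : (c • G) j *ᵥ w = (c : ℝ) • (G j *ᵥ w) := Matrix.smul_mulVec (c : ℝ) (G j) w
    rw [this]
    exact (V j).smul_mem _ ((hG j).2 w)⟩
  isClosed' := by
    simp only [Matrix.posSemidef_iff_dotProduct_mulVec, Matrix.IsHermitian]
    simp only [Set.ofPred_forall, Set.ofPred_and]
    refine isClosed_iInter fun j => ((isClosed_eq (by fun_prop) (by fun_prop)).inter
      (isClosed_iInter fun w => isClosed_le (by fun_prop) (by fun_prop))).inter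
      (isClosed_iInter fun w => (V j).closed_of_finiteDimensional.preimage (by fun_prop))

theorem mem_gramCone {ι n : Type*} [Fintype n] {V : ι → Submodule ℝ (n → ℝ)}
    {G : ι → Matrix n n ℝ} :
    G ∈ gramCone V ↔ ∀ j, (G j).PosSemidef ∧ ∀ w, G j *ᵥ w ∈ V j := Iff.rfl

theorem vecMulVec_mem_gramCone {ι n : Type*} [Fintype n] {V : ι → Submodule ℝ (n → ℝ)}
    {v : ι → n → ℝ} (hv : ∀ j, v j ∈ V j) :
    (fun j => vecMulVec (v j) (v j)) ∈ gramCone V := by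
  refine mem_gramCone.2 fun j => ⟨by simpa using posSemidef_vecMulVec_self_star (v j), fun w => ?_⟩
  rw [vecMulVec_mulVec]
  simpa using (V j).smul_mem _ (hv j)

/-- The weighted sum of the diagonals of a family of matrices. -/
noncomputable def weightedDiag {ι n : Type*} [Fintype ι] [Fintype n] (w : ι → n → ℝ) :
    (ι → Matrix n n ℝ) →L[ℝ] (n → ℝ) where
  toFun G r := ∑ j, w j r * G j r r
  map_add' G H := by ext r; simp [mul_add, Finset.sum_add_distrib]
  map_smul' c G := by ext r; simp [Finset.mul_sum, mul_left_comm]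
  cont := by fun_prop

theorem weightedDiag_apply {ι n : Type*} [Fintype ι] [Fintype n] (w : ι → n → ℝ)
    (G : ι → Matrix n n ℝ) (r : n) : weightedDiag w G r = ∑ j, w j r * G j r r := rfl

open scoped Matrix.Norms.Elementwise in
/-- **Generalized Farkas lemma** for cones of weighted sums of squares: a vector on which every
functional nonnegative on weighted squares is nonnegative is itself a weighted sum of squares. -/
theorem exists_weighted_sum_sq_of_dual_nonneg {ι n : Type*} [Fintype ι] [Fintype n]
    [DecidableEq n] (w : ι → n → ℝ) (hw : ∀ j r, 0 ≤ w j r) (V : ι → Submodule ℝ (n → ℝ))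
    (hV : ∀ j, ∀ v ∈ V j, (∀ r, w j r * v r = 0) → v = 0) (y : n → ℝ)
    (hy : ∀ lam : n → ℝ, (∀ v : ι → n → ℝ, (∀ j, v j ∈ V j) →
      0 ≤ ∑ r, lam r * ∑ j, w j r * v j r ^ 2) → 0 ≤ ∑ r, lam r * y r) :
    ∃ v : n → ι → n → ℝ, (∀ i j, v i j ∈ V j) ∧
      ∀ r, y r = ∑ j, w j r * ∑ i, v i j r ^ 2 := by
  have hker : ∀ G ∈ gramCone V, weightedDiag w G = 0 → G = 0 := by
    intro G hG h0
    funext j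
    have hdiag : ∀ r, w j r * G j r r = 0 := fun r =>
      (Finset.sum_eq_zero_iff_of_nonneg fun k _ =>
        mul_nonneg (hw k r) (hG k).1.diag_nonneg).1 (congrFun h0 r) j (Finset.mem_univ j)
    have hcol : ∀ s, (G j).col s = 0 := fun s => by
      refine hV j _ (by simpa using (hG j).2 (Pi.single s 1)) fun r => ?_
      rcases mul_eq_zero.1 (hdiag r) with h | h
      · simp [h]
      · simp [(hG j).1.apply_eq_zero_of_diag_eq_zero h s]
    ext r s
    exact congrFun (hcol s) r
  have hclosed := (gramCone V).isClosed_image (weightedDiag w) hker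
  have hmap : ((gramCone V).map (weightedDiag w) : Set (n → ℝ)) =
      weightedDiag w '' (gramCone V : Set (ι → Matrix n n ℝ)) := hclosed.closure_eq
  have hmem : y ∈ (gramCone V).map (weightedDiag w) := by
    by_contra hnot
    obtain ⟨f, hf, hfy⟩ := ProperCone.hyperplane_separation_point _ hnot
    have hfsum : ∀ z : n → ℝ, f z = ∑ r, f (Pi.single r 1) * z r := fun z => by
      conv_lhs => rw [pi_eq_sum_univ' z, map_sum]
      refine Finset.sum_congr rfl fun r _ => ?_
      rw [map_smul, smul_eq_mul, mul_comm]
    refine hfy.not_ge ?_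
    rw [hfsum]
    refine hy _ fun v hv => ?_
    have hpos := hf (weightedDiag w fun j => vecMulVec (v j) (v j))
      (hmap.ge ⟨_, vecMulVec_mem_gramCone hv, rfl⟩)
    rw [hfsum] at hpos
    simpa only [weightedDiag_apply, vecMulVec_apply, ← sq] using hpos
  obtain ⟨G, hG, rfl⟩ := hmap.le hmem
  choose v hvV hv using fun j => (hG j).1.exists_diag_eq_sum_sq (V j) (hG j).2
  exact ⟨fun i j => v j i, fun i j => hvV j i, fun r => by simp only [weightedDiag_apply, hv]⟩

/-- The polynomial with given coefficients on the multi-indices of degree at most `m`. -/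
noncomputable def polyOfCoeffs (d m : ℕ) : (MIdx d m → ℝ) →ₗ[ℝ] MvPolynomial (Fin d) ℝ :=
  Fintype.linearCombination ℝ monIdx

theorem polyOfCoeffs_apply {d m : ℕ} (c : MIdx d m → ℝ) :
    polyOfCoeffs d m c = ∑ α, c α • monIdx α := rfl

theorem totalDegree_monIdx_le {d m : ℕ} (α : MIdx d m) : (monIdx α).totalDegree ≤ m := by
  refine (totalDegree_finsetProd _ _).trans (le_trans (Finset.sum_le_sum fun i _ => ?_) α.2)
  simp

theorem range_polyOfCoeffs (d m : ℕ) :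
    LinearMap.range (polyOfCoeffs d m) = restrictTotalDegree (Fin d) ℝ m := by
  apply le_antisymm
  · rintro _ ⟨c, rfl⟩
    rw [polyOfCoeffs_apply]
    refine Submodule.sum_mem _ fun α _ => Submodule.smul_mem _ _ ?_
    exact (mem_restrictTotalDegree _ _ _).2 (totalDegree_monIdx_le α)
  · intro q hq
    rw [mem_restrictTotalDegree] at hq
    rw [q.as_sum]
    refine Submodule.sum_mem _ fun s hs => ?_
    have hsum : ∑ i, s i ≤ m := by
      have := (le_totalDegree hs).trans hq
      rwa [Finsupp.sum_fintype _ _ fun _ => rfl] at this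
    let α : MIdx d m := ⟨fun i => ⟨s i, Nat.lt_succ_of_le
      ((Finset.single_le_sum (fun _ _ => Nat.zero_le _) (Finset.mem_univ i)).trans hsum)⟩, hsum⟩
    refine ⟨Pi.single α (coeff s q), ?_⟩
    rw [polyOfCoeffs, Fintype.linearCombination_apply_single, monomial_eq, smul_eq_C_mul,
      Finsupp.prod_fintype _ _ fun _ => pow_zero _]
    rfl

theorem BEval_isSymm {d js : ℕ} (g : Fin js → MvPolynomial (Fin d) ℝ) (nj : Fin js → ℕ)
    (x : Fin d → ℝ) : (BEval g nj x).IsSymm := by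
  refine Matrix.IsSymm.ext fun ⟨j, α⟩ ⟨k, β⟩ => ?_
  by_cases h : j = k
  · subst h
    simp [BEval, BPoly, mul_right_comm]
  · simp [BEval, BPoly, h, Ne.symm h]

/-- The quadratic form of the localizing matrix at `x` is the weighted sum of squares at `x` of the
polynomials whose coefficients are the blocks of the vector. -/
theorem dotProduct_BEval_mulVec {d js : ℕ} (g : Fin js → MvPolynomial (Fin d) ℝ)
    (nj : Fin js → ℕ) (x : Fin d → ℝ) (W : ((j : Fin js) × MIdx d (nj j)) → ℝ) :
    W ⬝ᵥ BEval g nj x *ᵥ W =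
      ∑ j, eval x (g j) * eval x (polyOfCoeffs d (nj j) fun α => W ⟨j, α⟩) ^ 2 := by
  simp only [dotProduct, mulVec, Fintype.sum_sigma]
  refine Finset.sum_congr rfl fun j _ => ?_
  have hinner : ∀ α : MIdx d (nj j), ∑ k, ∑ β, BEval g nj x ⟨j, α⟩ ⟨k, β⟩ * W ⟨k, β⟩ =
      ∑ β, eval x (g j) * eval x (monIdx α) * eval x (monIdx β) * W ⟨j, β⟩ := fun α => by
    rw [Finset.sum_eq_single j]
    · simp [BEval, BPoly]
    · intro k _ hk
      simp [BEval, BPoly, hk.symm]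
    · simp
  simp only [hinner, polyOfCoeffs_apply, map_sum, smul_eval, sq, Finset.sum_mul_sum]
  simp only [Finset.mul_sum]
  exact Finset.sum_congr rfl fun α _ => Finset.sum_congr rfl fun β _ => by ring

theorem dotProduct_sum_smul_BEval_mulVec {d js rs : ℕ} (g : Fin js → MvPolynomial (Fin d) ℝ)
    (nj : Fin js → ℕ) (xr : Fin rs → Fin d → ℝ) (lam : Fin rs → ℝ)
    (W : ((j : Fin js) × MIdx d (nj j)) → ℝ) :
    W ⬝ᵥ (∑ r, lam r • BEval g nj (xr r)) *ᵥ W = ∑ r, lam r *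
      ∑ j, eval (xr r) (g j) * eval (xr r) (polyOfCoeffs d (nj j) fun α => W ⟨j, α⟩) ^ 2 := by
  simp only [Matrix.sum_mulVec, Matrix.smul_mulVec, dotProduct_sum, dotProduct_smul, smul_eq_mul,
    dotProduct_BEval_mulVec]

/-- The combination of localizing matrices is positive semidefinite iff the corresponding functional
is nonnegative on all weighted sums of squares. -/
theorem posSemidef_sum_smul_BEval_iff {d js rs : ℕ} (g : Fin js → MvPolynomial (Fin d) ℝ)
    (nj : Fin js → ℕ) (xr : Fin rs → Fin d → ℝ) (lam : Fin rs → ℝ) :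
    (∑ r, lam r • BEval g nj (xr r)).PosSemidef ↔
      ∀ q : Fin js → MvPolynomial (Fin d) ℝ, (∀ j, (q j).totalDegree ≤ nj j) →
        0 ≤ ∑ r, lam r * ∑ j, eval (xr r) (g j) * eval (xr r) (q j) ^ 2 := by
  constructor
  · intro h q hq
    have hq' : ∀ j, ∃ c, polyOfCoeffs d (nj j) c = q j := fun j =>
      (range_polyOfCoeffs d (nj j)).ge ((mem_restrictTotalDegree _ _ _).2 (hq j))
    choose c hc using hq'
    have := h.dotProduct_mulVec_nonneg fun p => c p.1 p.2
    rw [star_trivial, dotProduct_sum_smul_BEval_mulVec] at this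
    simpa only [hc] using this
  · intro h
    refine .of_dotProduct_mulVec_nonneg ?_ fun W => ?_
    · simp [Matrix.IsHermitian, Matrix.transpose_sum, (BEval_isSymm g nj _).eq]
    · rw [star_trivial, dotProduct_sum_smul_BEval_mulVec]
      refine h _ fun j => (mem_restrictTotalDegree _ _ _).1 ?_
      exact (range_polyOfCoeffs d (nj j)).le ⟨_, rfl⟩

theorem totalDegree_mul_sum_sq_le {σ R ι : Type*} [CommSemiring R] {g : MvPolynomial σ R}
    {n m : ℕ} (h : g.totalDegree + 2 * m ≤ n) (s : Finset ι) (q : ι → MvPolynomial σ R)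
    (hq : ∀ i ∈ s, (q i).totalDegree ≤ m) : (g * ∑ i ∈ s, q i ^ 2).totalDegree ≤ n := by
  refine (totalDegree_mul _ _).trans ((Nat.add_le_add_left ?_ _).trans h)
  refine totalDegree_finsetSum_le fun i hi => (totalDegree_pow _ _).trans ?_
  exact Nat.mul_le_mul_left 2 (hq i hi)

theorem farkas_characterization_of_sos
    (d js n rs : ℕ)
    (g : Fin js → MvPolynomial (Fin d) ℝ)
    (hgn : ∀ j, (g j).totalDegree ≤ n)
    (nj : Fin js → ℕ) (hnj : ∀ j, nj j = (n - (g j).totalDegree) / 2)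
    (xr : Fin rs → Fin d → ℝ)
    (hxK : ∀ r, ∀ j, 0 ≤ eval (xr r) (g j))
    (l : Fin rs → MvPolynomial (Fin d) ℝ)
    (hldeg : ∀ r, (l r).totalDegree ≤ n)
    (hdelta : ∀ r s, eval (xr s) (l r) = if r = s then (1 : ℝ) else 0)
    (huni : ∀ p : MvPolynomial (Fin d) ℝ, p.totalDegree ≤ n →
      p = ∑ r, C (eval (xr r) p) * l r)
    (p : MvPolynomial (Fin d) ℝ) (hpdeg : p.totalDegree ≤ n)
    (hpos : ∀ x : Fin d → ℝ, (∀ j, 0 ≤ eval x (g j)) → 0 ≤ eval x p) :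
    (∀ lam : Fin rs → ℝ, (∑ r, lam r • BEval g nj (xr r)).PosSemidef →
        0 ≤ ∑ r, lam r * eval (xr r) p) ↔
    (∃ q : Fin rs → Fin js → MvPolynomial (Fin d) ℝ,
        (∀ i j, (q i j).totalDegree ≤ nj j) ∧
        p = ∑ j, g j * ∑ i, (q i j) ^ 2) := by
  have hdeg : ∀ j, (g j).totalDegree + 2 * nj j ≤ n := fun j => by
    have := hgn j
    have := hnj j
    omega
  have hext : ∀ a b : MvPolynomial (Fin d) ℝ, a.totalDegree ≤ n → b.totalDegree ≤ n →
      (∀ r, eval (xr r) a = eval (xr r) b) → a = b := fun a b ha hb hab => by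
    rw [huni a ha, huni b hb]
    simp only [hab]
  constructor
  · intro h
    let ev : MvPolynomial (Fin d) ℝ →ₗ[ℝ] (Fin rs → ℝ) :=
      LinearMap.pi fun r => (aeval (xr r)).toLinearMap
    have hev : ∀ q r, ev q r = eval (xr r) q := fun q r => by simp [ev]
    let V : Fin js → Submodule ℝ (Fin rs → ℝ) := fun j =>
      if g j = 0 then ⊥ else (restrictTotalDegree (Fin d) ℝ (nj j)).map ev
    have hVpoly : ∀ j, ∀ v ∈ V j, ∃ q, q.totalDegree ≤ nj j ∧ ∀ r, eval (xr r) q = v r := by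
      intro j v hv
      by_cases hg : g j = 0
      · refine ⟨0, by simp, fun r => ?_⟩
        simp only [V, hg, if_true, Submodule.mem_bot] at hv
        simp [hv]
      · simp only [V, hg, if_false] at hv
        obtain ⟨q, hq, rfl⟩ := hv
        exact ⟨q, (mem_restrictTotalDegree _ _ _).1 hq, fun r => (hev q r).symm⟩
    have hVinj : ∀ j, ∀ v ∈ V j, (∀ r, eval (xr r) (g j) * v r = 0) → v = 0 := by
      intro j v hv hzero
      by_cases hg : g j = 0
      · simpa [V, hg] using hv
      · simp only [V, hg, if_false] at hv
        obtain ⟨q, hq, rfl⟩ := hv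
        have hq' := (mem_restrictTotalDegree _ _ _).1 hq
        have hgq : g j * q = 0 := by
          refine hext _ _ ((totalDegree_mul _ _).trans ?_) (by simp) fun r => ?_
          · have := hdeg j
            omega
          · simpa [hev] using hzero r
        simp [(mul_eq_zero.1 hgq).resolve_left hg]
    have hdual : ∀ lam : Fin rs → ℝ, (∀ v : Fin js → Fin rs → ℝ, (∀ j, v j ∈ V j) →
        0 ≤ ∑ r, lam r * ∑ j, eval (xr r) (g j) * v j r ^ 2) →
        0 ≤ ∑ r, lam r * eval (xr r) p := by
      intro lam hlam
      refine h lam ((posSemidef_sum_smul_BEval_iff g nj xr lam).2 fun q hq => ?_)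
      have := hlam (fun j => if g j = 0 then 0 else ev (q j)) fun j => by
        by_cases hg : g j = 0
        · simp [hg]
        · simpa only [V, hg, if_false] using
            Submodule.mem_map_of_mem ((mem_restrictTotalDegree _ _ _).2 (hq j))
      refine this.trans_eq (Finset.sum_congr rfl fun r _ => ?_)
      congr 1
      refine Finset.sum_congr rfl fun j _ => ?_
      by_cases hg : g j = 0 <;> simp [hg, hev]
    obtain ⟨v, hvV, hv⟩ := exists_weighted_sum_sq_of_dual_nonneg
      (fun j r => eval (xr r) (g j)) (fun j r => hxK r j) V hVinj (fun r => eval (xr r) p)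
      hdual
    choose q hqdeg hq using fun i j => hVpoly j (v i j) (hvV i j)
    refine ⟨q, hqdeg, hext _ _ hpdeg ?_ fun r => ?_⟩
    · exact totalDegree_finsetSum_le fun j _ =>
        totalDegree_mul_sum_sq_le (hdeg j) _ _ fun i _ => hqdeg i j
    · simp [hv, hq]
  · rintro ⟨q, hq, rfl⟩ lam hlam
    have h := Finset.sum_nonneg fun i (_ : i ∈ Finset.univ) =>
      (posSemidef_sum_smul_BEval_iff g nj xr lam).1 hlam (q i) (hq i)
    refine h.trans_eq ?_
    simp only [map_sum, map_mul, map_pow, Finset.mul_sum]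
    rw [Finset.sum_comm]
    exact Finset.sum_congr rfl fun r _ => Finset.sum_comm
end

section
/- (Univariate main theorem.) For any univariate polynomial $p$ strictly positive on $[0,1]$, and any choice of $n+1$ distinct interpolation points in $[0,1]$ with $n\geq\deg p$, the associated dual function $G(\lambda) = \mathrm{tr}(M(\lambda)^{-1}) + \sum_r p(x_r)\lambda_r$ is strictly convex and coercive on its domain $\mathcal{D} = \{\lambda : M(\lambda)\succ 0\}$; consequently $G$ has a unique critical point $\lambda^*\in\mathcal{D}$, and $\nabla G(\lambda^*) = 0$ yields a weighted sum-of-squares decomposition of $p$ on $[0,1]$. -/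
open Matrix BigOperators

/-- The 1D block-diagonal localizing matrix at a point `t`, with the Lukács weights:
for `n` odd (`n = 2k+1`), the two blocks are `t · (t^i t^j)_{0≤i,j≤k}` and
`(1-t) · (t^i t^j)_{0≤i,j≤k}`; for `n` even (`n = 2k`), they are
`(t^i t^j)_{0≤i,j≤k}` and `t(1-t) · (t^i t^j)_{0≤i,j≤k-1}`.
The first block occupies the indices `< n/2 + 1`. -/
def B1D (n : ℕ) (t : ℝ) : Matrix (Fin (n + 1)) (Fin (n + 1)) ℝ :=
  fun i j =>
    if (i : ℕ) < n / 2 + 1 ∧ (j : ℕ) < n / 2 + 1 then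
      (if n % 2 = 1 then t else 1) * t ^ (i : ℕ) * t ^ (j : ℕ)
    else if n / 2 + 1 ≤ (i : ℕ) ∧ n / 2 + 1 ≤ (j : ℕ) then
      (if n % 2 = 1 then 1 - t else t * (1 - t)) *
        t ^ ((i : ℕ) - (n / 2 + 1)) * t ^ ((j : ℕ) - (n / 2 + 1))
    else 0

/-- `M(λ) = I + ∑ r λ_r B_r` for the 1D localizing matrices. -/
noncomputable def M1D (n : ℕ) (x : Fin (n + 1) → ℝ) (lam : Fin (n + 1) → ℝ) :
    Matrix (Fin (n + 1)) (Fin (n + 1)) ℝ :=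
  1 + ∑ r, lam r • B1D n (x r)

/-- The dual function `G(λ) = tr(M(λ)⁻¹) + ∑ r p(x_r) λ_r`. -/
noncomputable def G1D (n : ℕ) (x : Fin (n + 1) → ℝ) (p : Polynomial ℝ)
    (lam : EuclideanSpace ℝ (Fin (n + 1))) : ℝ :=
  (M1D n x lam)⁻¹.trace + ∑ r, p.eval (x r) * lam r

open Polynomial in
/-- The Lukács weight of the first block. -/
noncomputable def lukacsWeightLow (n : ℕ) : ℝ[X] := if n % 2 = 1 then X else 1

open Polynomial in
/-- The Lukács weight of the second block. -/
noncomputable def lukacsWeightHigh (n : ℕ) : ℝ[X] :=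
  if n % 2 = 1 then 1 - X else X * (1 - X)

open Polynomial in
/-- The weighted squares of degree at most `n`. -/
def lukacsSquares (n : ℕ) : Set ℝ[X] :=
  {f | ∃ a : ℝ[X], a.degree < (n / 2 + 1 : ℕ) ∧ f = lukacsWeightLow n * a ^ 2} ∪
  {f | ∃ b : ℝ[X], b.degree < (n + 1 - (n / 2 + 1) : ℕ) ∧ f = lukacsWeightHigh n * b ^ 2}

/-- The cone of sums of weighted squares of degree at most `n`. -/
noncomputable def lukacsCone (n : ℕ) : AddSubmonoid (Polynomial ℝ) :=
  AddSubmonoid.closure (lukacsSquares n)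

section Lukacs

open Polynomial

theorem Polynomial.degree_mul_lt_of_lt_of_le {a l : ℝ[X]} {k m d : ℕ} (ha : a.degree < k)
    (hl : l.degree ≤ d) (h : k + d ≤ m) : (l * a).degree < m := by
  rcases eq_or_ne a 0 with rfl | ha0
  · simp [bot_lt_iff_ne_bot]
  rw [degree_eq_natDegree ha0, Nat.cast_lt] at ha
  have h1 := natDegree_le_of_degree_le hl
  have h2 : (l * a).natDegree ≤ l.natDegree + a.natDegree := natDegree_mul_le
  exact degree_le_natDegree.trans_lt (by exact_mod_cast (by omega))

theorem mul_mem_lukacsCone {n m : ℕ} {g f : ℝ[X]}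
    (h : ∀ s ∈ lukacsSquares n, g * s ∈ lukacsSquares m) (hf : f ∈ lukacsCone n) :
    g * f ∈ lukacsCone m := by
  induction hf using AddSubmonoid.closure_induction with
  | mem s hs => exact AddSubmonoid.subset_closure (h s hs)
  | zero => simp
  | add a b _ _ ha hb => rw [mul_add]; exact add_mem ha hb

theorem C_mul_mem_lukacsCone {n : ℕ} {c : ℝ} (hc : 0 ≤ c) {f : ℝ[X]} (hf : f ∈ lukacsCone n) :
    C c * f ∈ lukacsCone n := by
  have hs : C c = (C (Real.sqrt c)) ^ 2 := by rw [← C_pow, Real.sq_sqrt hc]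
  refine mul_mem_lukacsCone ?_ hf
  rintro s (⟨a, ha, rfl⟩ | ⟨a, ha, rfl⟩)
  · exact Or.inl ⟨C (Real.sqrt c) * a, degree_mul_lt_of_lt_of_le (d := 0) ha degree_C_le (by simp),
      by rw [hs]; ring⟩
  · exact Or.inr ⟨C (Real.sqrt c) * a, degree_mul_lt_of_lt_of_le (d := 0) ha degree_C_le (by simp),
      by rw [hs]; ring⟩

theorem sq_mul_mem_lukacsCone {n : ℕ} {l f : ℝ[X]} (hl : l.degree ≤ 1) (hf : f ∈ lukacsCone n) :
    l ^ 2 * f ∈ lukacsCone (n + 2) := by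
  refine mul_mem_lukacsCone ?_ hf
  rintro s (⟨a, ha, rfl⟩ | ⟨a, ha, rfl⟩)
  · exact Or.inl ⟨l * a, degree_mul_lt_of_lt_of_le (d := 1) ha (by simpa using hl) (by omega),
      by simp only [lukacsWeightLow, Nat.add_mod_right]; ring⟩
  · exact Or.inr ⟨l * a, degree_mul_lt_of_lt_of_le (d := 1) ha (by simpa using hl) (by omega),
      by simp only [lukacsWeightHigh, Nat.add_mod_right]; ring⟩

theorem X_mul_mem_lukacsCone {n : ℕ} {f : ℝ[X]} (hf : f ∈ lukacsCone n) :
    X * f ∈ lukacsCone (n + 1) := by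
  refine mul_mem_lukacsCone ?_ hf
  rcases Nat.mod_two_eq_zero_or_one n with h | h
  · have h' : (n + 1) % 2 = 1 := by omega
    rintro s (⟨a, ha, rfl⟩ | ⟨a, ha, rfl⟩)
    · exact Or.inl ⟨a, ha.trans_le (by exact_mod_cast (by omega)),
        by simp [lukacsWeightLow, h, h']⟩
    · exact Or.inr ⟨X * a, degree_mul_lt_of_lt_of_le (d := 1) ha (by simp) (by omega),
        by simp [lukacsWeightHigh, h, h']; ring⟩
  · have h' : (n + 1) % 2 = 0 := by omega
    rintro s (⟨a, ha, rfl⟩ | ⟨a, ha, rfl⟩)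
    · exact Or.inl ⟨X * a, degree_mul_lt_of_lt_of_le (d := 1) ha (by simp) (by omega),
        by simp [lukacsWeightLow, h, h']; ring⟩
    · exact Or.inr ⟨a, ha.trans_le (by exact_mod_cast (by omega)),
        by simp [lukacsWeightHigh, h, h']; ring⟩

theorem one_sub_X_mul_mem_lukacsCone {n : ℕ} {f : ℝ[X]} (hf : f ∈ lukacsCone n) :
    (1 - X) * f ∈ lukacsCone (n + 1) := by
  have hX : (1 - X : ℝ[X]).degree ≤ (1 : ℕ) := by
    refine (degree_sub_le _ _).trans ?_
    simp
  refine mul_mem_lukacsCone ?_ hf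
  rcases Nat.mod_two_eq_zero_or_one n with h | h
  · have h' : (n + 1) % 2 = 1 := by omega
    rintro s (⟨a, ha, rfl⟩ | ⟨a, ha, rfl⟩)
    · exact Or.inr ⟨a, ha.trans_le (by exact_mod_cast (by omega)),
        by simp [lukacsWeightLow, lukacsWeightHigh, h, h']⟩
    · exact Or.inl ⟨(1 - X) * a, degree_mul_lt_of_lt_of_le (d := 1) ha hX (by omega),
        by simp [lukacsWeightLow, lukacsWeightHigh, h, h']; ring⟩
  · have h' : (n + 1) % 2 = 0 := by omega
    rintro s (⟨a, ha, rfl⟩ | ⟨a, ha, rfl⟩)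
    · exact Or.inr ⟨a, ha.trans_le (by exact_mod_cast (by omega)),
        by simp [lukacsWeightLow, lukacsWeightHigh, h, h']; ring⟩
    · exact Or.inl ⟨(1 - X) * a, degree_mul_lt_of_lt_of_le (d := 1) ha hX (by omega),
        by simp [lukacsWeightLow, lukacsWeightHigh, h, h']; ring⟩

theorem lukacsCone_le_succ {n : ℕ} : lukacsCone n ≤ lukacsCone (n + 1) := fun f hf => by
  have := add_mem (X_mul_mem_lukacsCone hf) (one_sub_X_mul_mem_lukacsCone hf)
  rwa [← add_mul, add_sub_cancel, one_mul] at this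

theorem C_mem_lukacsCone (n : ℕ) {c : ℝ} (hc : 0 ≤ c) : C c ∈ lukacsCone n := by
  induction n with
  | zero =>
    have h1 : (1 : ℝ[X]) ∈ lukacsCone 0 :=
      AddSubmonoid.subset_closure (Or.inl ⟨1, by simp, by simp [lukacsWeightLow]⟩)
    simpa using C_mul_mem_lukacsCone hc h1
  | succ k ih => exact lukacsCone_le_succ ih

/-- The Lukács decomposition: a polynomial of degree at most `n` that is positive on `[0, 1]` is a
sum of weighted squares of degree at most `n`. -/
theorem mem_lukacsCone_of_pos (n : ℕ) (p : ℝ[X]) (hdeg : p.natDegree ≤ n)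
    (hp : ∀ t ∈ Set.Icc (0 : ℝ) 1, 0 < p.eval t) : p ∈ lukacsCone n := by
  induction n using Nat.strong_induction_on generalizing p with
  | _ n ih =>
  have hp0 : p ≠ 0 := by
    rintro rfl
    simpa using hp 0 (by simp)
  by_cases hd : p.natDegree = 0
  · obtain ⟨c, rfl⟩ := natDegree_eq_zero.mp hd
    exact C_mem_lukacsCone n (by simpa using (hp 0 (by simp)).le)
  obtain ⟨z, hz⟩ := IsAlgClosed.exists_aeval_eq_zero ℂ p
    (fun h => hd (natDegree_eq_zero_iff_degree_le_zero.mpr h.le))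
  by_cases him : z.im = 0
  · have hr : p.IsRoot z.re := by
      have hzr : z = algebraMap ℝ ℂ z.re := Complex.ext (by simp) (by simpa using him)
      rw [hzr, aeval_algebraMap_apply_eq_algebraMap_eval] at hz
      simpa using hz
    obtain ⟨q, rfl⟩ := dvd_iff_isRoot.mpr hr
    have hq0 : q ≠ 0 := right_ne_zero_of_mul hp0
    rw [natDegree_mul (X_sub_C_ne_zero _) hq0, natDegree_X_sub_C] at hdeg
    obtain ⟨m, rfl⟩ : ∃ m, n = m + 1 := ⟨n - 1, by omega⟩
    rcases lt_or_ge z.re 0 with h | h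
    · have hq := ih m (by omega) q (by omega) fun t ht => by
        have := hp t ht
        simp only [eval_mul, eval_sub, eval_X, eval_C] at this
        exact (pos_iff_pos_of_mul_pos this).mp (by linarith [ht.1])
      have := add_mem (C_mul_mem_lukacsCone (c := 1 - z.re) (by linarith) (X_mul_mem_lukacsCone hq))
        (C_mul_mem_lukacsCone (c := -z.re) (by linarith) (one_sub_X_mul_mem_lukacsCone hq))
      convert this using 1
      simp only [C_sub, C_neg, C_1]
      ring
    rcases lt_or_ge 1 z.re with h' | h'
    · have hq := ih m (by omega) (-q) (by simpa using by omega) fun t ht => by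
        have := hp t ht
        simp only [eval_mul, eval_sub, eval_X, eval_C] at this
        rw [← neg_mul_neg] at this
        rw [eval_neg]
        exact (pos_iff_pos_of_mul_pos this).mp (by linarith [ht.2])
      have := add_mem (C_mul_mem_lukacsCone (c := z.re - 1) (by linarith) (X_mul_mem_lukacsCone hq))
        (C_mul_mem_lukacsCone (c := z.re) (by linarith) (one_sub_X_mul_mem_lukacsCone hq))
      convert this using 1
      simp only [C_sub, C_1]
      ring
    · exact absurd (hp z.re ⟨h, h'⟩) (by rw [hr]; exact lt_irrefl 0)
  · obtain ⟨q, hpq⟩ := quadratic_dvd_of_aeval_eq_zero_im_ne_zero p hz him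
    have hfac : X ^ 2 - C (2 * z.re) * X + C (‖z‖ ^ 2) = (X - C z.re) ^ 2 + (C z.im) ^ 2 := by
      rw [Complex.sq_norm, Complex.normSq_apply]
      simp only [C_add, C_mul, C_ofNat]
      ring
    have hmon : (X ^ 2 - C (2 * z.re) * X + C (‖z‖ ^ 2)).natDegree = 2 := by compute_degree!
    have hq0 : q ≠ 0 := by rintro rfl; exact hp0 (by simpa using hpq)
    have hdp : p.natDegree = 2 + q.natDegree := by
      rw [hpq, natDegree_mul _ hq0, hmon]
      intro h0
      rw [h0] at hmon
      simp at hmon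
    obtain ⟨m, rfl⟩ : ∃ m, n = m + 2 := ⟨n - 2, by omega⟩
    have hq := ih m (by omega) q (by omega) fun t ht => by
      have := hp t ht
      rw [hpq, hfac, eval_mul] at this
      simp only [eval_add, eval_pow, eval_sub, eval_X, eval_C] at this
      exact (pos_iff_pos_of_mul_pos this).mp (by positivity)
    rw [hpq, hfac, add_mul]
    exact add_mem (sq_mul_mem_lukacsCone (degree_X_sub_C_le _) hq)
      (sq_mul_mem_lukacsCone (degree_C_le.trans (by simp)) hq)

end Lukacs

section Trace

variable {ι : Type*} [Fintype ι]

theorem Matrix.trace_transpose_mul_mul (X B : Matrix ι ι ℝ) :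
    (Xᵀ * B * X).trace = ∑ i, X.col i ⬝ᵥ B *ᵥ X.col i := by
  refine Finset.sum_congr rfl fun i _ => ?_
  rw [diag_apply, Matrix.mul_assoc]
  rfl

theorem Matrix.PosDef.trace_transpose_mul_mul_pos {B X : Matrix ι ι ℝ} (hB : B.PosDef)
    (hX : X ≠ 0) : 0 < (Xᵀ * B * X).trace := by
  rw [trace_transpose_mul_mul]
  obtain ⟨i, hi⟩ : ∃ i, X.col i ≠ 0 := by
    by_contra! h
    exact hX (Matrix.ext fun k i => congrFun (h i) k)
  exact Finset.sum_pos' (fun j _ => hB.posSemidef.dotProduct_mulVec_nonneg _)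
    ⟨i, Finset.mem_univ _, hB.dotProduct_mulVec_pos hi⟩

theorem Matrix.PosDef.transpose_inv_eq [DecidableEq ι] {A : Matrix ι ι ℝ} (hA : A.PosDef) :
    (A⁻¹)ᵀ = A⁻¹ := by
  simpa [IsHermitian] using hA.inv.isHermitian

/-- The tangent inequality for the trace of the inverse. -/
theorem Matrix.PosDef.trace_inv_sub_lt [DecidableEq ι] {A B : Matrix ι ι ℝ} (hA : A.PosDef)
    (hB : B.PosDef) (hAB : A ≠ B) :
    A⁻¹.trace - (A⁻¹ * (B - A) * A⁻¹).trace < B⁻¹.trace := by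
  have hA' : IsUnit A.det := (isUnit_iff_isUnit_det _).mp hA.isUnit
  have hB' : IsUnit B.det := (isUnit_iff_isUnit_det _).mp hB.isUnit
  have hX : A⁻¹ - B⁻¹ ≠ 0 := by
    rw [sub_ne_zero]
    intro h
    exact hAB (by rw [← nonsing_inv_nonsing_inv A hA', h, nonsing_inv_nonsing_inv B hB'])
  have key := hB.trace_transpose_mul_mul_pos hX
  have expand : (A⁻¹ - B⁻¹)ᵀ * B * (A⁻¹ - B⁻¹) = A⁻¹ * (B - A) * A⁻¹ - A⁻¹ + B⁻¹ := by
    rw [transpose_sub, hA.transpose_inv_eq, hB.transpose_inv_eq]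
    simp only [sub_mul, mul_sub, nonsing_inv_mul _ hA', nonsing_inv_mul _ hB', one_mul]
    rw [mul_assoc A⁻¹ B B⁻¹, mul_nonsing_inv _ hB', mul_one]
    abel
  rw [expand, trace_add, trace_sub] at key
  linarith

theorem Matrix.PosSemidef.dotProduct_mulVec_le_trace {N : Matrix ι ι ℝ} (hN : N.PosSemidef)
    (v : ι → ℝ) : v ⬝ᵥ N *ᵥ v ≤ N.trace * (v ⬝ᵥ v) := by
  obtain ⟨m, w, rfl⟩ := posSemidef_iff_eq_sum_vecMulVec.mp hN
  simp only [star_trivial, sum_mulVec, dotProduct_sum, trace_sum, trace_vecMulVec,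
    vecMulVec_mulVec, dotProduct_smul, op_smul_eq_smul, smul_eq_mul, Finset.sum_mul]
  refine Finset.sum_le_sum fun i _ => ?_
  have h := Finset.sum_mul_sq_le_sq_mul_sq Finset.univ (w i) v
  simp only [sq] at h
  rw [dotProduct_comm v (w i)]
  exact h

/-- An upper bound for the trace of the inverse bounds the matrix away from the boundary of the
positive definite cone. -/
theorem Matrix.PosDef.dotProduct_self_le [DecidableEq ι] {A : Matrix ι ι ℝ} (hA : A.PosDef)
    {c : ℝ} (hc : 0 < c) (htr : A⁻¹.trace ≤ c) (v : ι → ℝ) :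
    v ⬝ᵥ v ≤ c * (v ⬝ᵥ A *ᵥ v) := by
  have hA' : IsUnit A.det := (isUnit_iff_isUnit_det _).mp hA.isUnit
  have hv : 0 ≤ v ⬝ᵥ v := Finset.sum_nonneg fun i _ => mul_self_nonneg _
  have h1 := (hA.inv.posSemidef.dotProduct_mulVec_le_trace v).trans
    (mul_le_mul_of_nonneg_right htr hv)
  have h2 := hA.inv.posSemidef.dotProduct_mulVec_nonneg (v - c • A *ᵥ v)
  have h3 : (A *ᵥ v) ⬝ᵥ (A⁻¹ *ᵥ v) = v ⬝ᵥ v := by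
    rw [dotProduct_mulVec, ← mulVec_transpose, hA.transpose_inv_eq, mulVec_mulVec,
      nonsing_inv_mul _ hA', one_mulVec]
  have h4 : A⁻¹ *ᵥ (A *ᵥ v) = v := by rw [mulVec_mulVec, nonsing_inv_mul _ hA', one_mulVec]
  simp only [star_trivial, mulVec_sub, mulVec_smul, h4, sub_dotProduct, dotProduct_sub,
    smul_dotProduct, dotProduct_smul, h3, smul_eq_mul] at h2
  rw [dotProduct_comm (A *ᵥ v) v] at h2
  have h5 : 0 ≤ c * (c * (v ⬝ᵥ A *ᵥ v) - v ⬝ᵥ v) := by linarith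
  linarith [nonneg_of_mul_nonneg_right h5 hc]

theorem Matrix.abs_dotProduct_mulVec_le (E : Matrix ι ι ℝ) (v : ι → ℝ) :
    |v ⬝ᵥ E *ᵥ v| ≤ (∑ i, ∑ j, |E i j|) * (v ⬝ᵥ v) := by
  have hle : ∀ i, v i * v i ≤ v ⬝ᵥ v := fun i =>
    Finset.single_le_sum (f := fun i => v i * v i) (fun i _ => mul_self_nonneg _)
      (Finset.mem_univ i)
  have hexp : v ⬝ᵥ E *ᵥ v = ∑ i, ∑ j, v i * (E i j * v j) := by
    simp only [dotProduct, mulVec, Finset.mul_sum]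
  rw [hexp]
  simp only [Finset.sum_mul]
  refine (Finset.abs_sum_le_sum_abs _ _).trans (Finset.sum_le_sum fun i _ => ?_)
  refine (Finset.abs_sum_le_sum_abs _ _).trans (Finset.sum_le_sum fun j _ => ?_)
  rw [abs_mul, abs_mul, mul_left_comm]
  refine mul_le_mul_of_nonneg_left ?_ (abs_nonneg _)
  have := two_mul_le_add_sq |v i| |v j|
  rw [sq_abs, sq_abs] at this
  linarith [hle i, hle j]

end Trace

section LocalizingMatrix

open Polynomial

/-- The vector of monomials of the first block at `t`. -/
def lowVec (n : ℕ) (t : ℝ) (i : Fin (n + 1)) : ℝ :=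
  if (i : ℕ) < n / 2 + 1 then t ^ (i : ℕ) else 0

/-- The vector of monomials of the second block at `t`. -/
def highVec (n : ℕ) (t : ℝ) (i : Fin (n + 1)) : ℝ :=
  if (i : ℕ) < n / 2 + 1 then 0 else t ^ ((i : ℕ) - (n / 2 + 1))

/-- The polynomial whose coefficients are the first block of `v`. -/
noncomputable def lowPoly (n : ℕ) (v : Fin (n + 1) → ℝ) : ℝ[X] :=
  ∑ i : Fin (n + 1), if (i : ℕ) < n / 2 + 1 then C (v i) * X ^ (i : ℕ) else 0

/-- The polynomial whose coefficients are the second block of `v`. -/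
noncomputable def highPoly (n : ℕ) (v : Fin (n + 1) → ℝ) : ℝ[X] :=
  ∑ i : Fin (n + 1), if (i : ℕ) < n / 2 + 1 then 0 else C (v i) * X ^ ((i : ℕ) - (n / 2 + 1))

theorem degree_lowPoly_lt (n : ℕ) (v : Fin (n + 1) → ℝ) :
    (lowPoly n v).degree < (n / 2 + 1 : ℕ) := by
  refine (degree_sum_le _ _).trans_lt ((Finset.sup_lt_iff (WithBot.bot_lt_coe _)).mpr fun i _ => ?_)
  split_ifs with h
  · exact (degree_C_mul_X_pow_le _ _).trans_lt (by exact_mod_cast h)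
  · exact WithBot.bot_lt_coe _

theorem degree_highPoly_lt (n : ℕ) (v : Fin (n + 1) → ℝ) :
    (highPoly n v).degree < (n + 1 - (n / 2 + 1) : ℕ) := by
  refine (degree_sum_le _ _).trans_lt ((Finset.sup_lt_iff (WithBot.bot_lt_coe _)).mpr fun i _ => ?_)
  split_ifs with h
  · exact WithBot.bot_lt_coe _
  · exact (degree_C_mul_X_pow_le _ _).trans_lt (by exact_mod_cast (by omega))

theorem eval_lowPoly (n : ℕ) (v : Fin (n + 1) → ℝ) (t : ℝ) :
    (lowPoly n v).eval t = lowVec n t ⬝ᵥ v := by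
  rw [lowPoly, eval_finsetSum]
  refine Finset.sum_congr rfl fun i _ => ?_
  rw [lowVec]
  split_ifs
  · simp [mul_comm (v i)]
  · simp

theorem eval_highPoly (n : ℕ) (v : Fin (n + 1) → ℝ) (t : ℝ) :
    (highPoly n v).eval t = highVec n t ⬝ᵥ v := by
  rw [highPoly, eval_finsetSum]
  refine Finset.sum_congr rfl fun i _ => ?_
  rw [highVec]
  split_ifs
  · simp
  · simp [mul_comm (v i)]

theorem B1D_eq (n : ℕ) (t : ℝ) :
    B1D n t = (lukacsWeightLow n).eval t • vecMulVec (lowVec n t) (lowVec n t) +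
      (lukacsWeightHigh n).eval t • vecMulVec (highVec n t) (highVec n t) := by
  ext i j
  simp only [B1D, lukacsWeightLow, lukacsWeightHigh, lowVec, highVec, Matrix.add_apply,
    Matrix.smul_apply, vecMulVec_apply, smul_eq_mul]
  generalize n / 2 + 1 = k
  have hcases : ∀ m : ℕ, (m < k ∧ ¬ k ≤ m) ∨ (¬ m < k ∧ k ≤ m) := by omega
  rcases hcases i with ⟨hi, hi'⟩ | ⟨hi, hi'⟩ <;> rcases hcases j with ⟨hj, hj'⟩ | ⟨hj, hj'⟩ <;>
    by_cases hn : n % 2 = 1 <;>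
    simp [hi, hj, hi', hj', hn, mul_assoc]

theorem dotProduct_B1D_mulVec (n : ℕ) (t : ℝ) (v : Fin (n + 1) → ℝ) :
    v ⬝ᵥ B1D n t *ᵥ v =
      (lukacsWeightLow n * lowPoly n v ^ 2 + lukacsWeightHigh n * highPoly n v ^ 2).eval t := by
  rw [B1D_eq]
  simp only [add_mulVec, smul_mulVec, vecMulVec_mulVec, dotProduct_add, dotProduct_smul,
    eval_add, eval_mul, eval_pow, eval_lowPoly, eval_highPoly, smul_eq_mul, op_smul_eq_smul]
  rw [dotProduct_comm v (lowVec n t), dotProduct_comm v (highVec n t)]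
  ring

theorem isSymm_B1D (n : ℕ) (t : ℝ) : (B1D n t)ᵀ = B1D n t := by
  simp [B1D_eq, transpose_vecMulVec]

theorem Fin.sum_univ_split {M : Type*} [AddCommMonoid M] (f : ℕ → M) {k n : ℕ} (h : k ≤ n) :
    ∑ i : Fin n, f i = ∑ i ∈ Finset.range k, f i + ∑ i ∈ Finset.range (n - k), f (k + i) := by
  rw [Fin.sum_univ_eq_sum_range, ← Finset.sum_range_add, Nat.add_sub_cancel' h]

theorem Polynomial.sum_range_C_mul_X_pow_of_degree_lt {a : ℝ[X]} {k : ℕ} (ha : a.degree < k) :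
    ∑ i ∈ Finset.range k, C (a.coeff i) * X ^ i = a := by
  rcases eq_or_ne a 0 with rfl | ha0
  · simp
  · exact (as_sum_range_C_mul_X_pow' a ((natDegree_lt_iff_degree_lt ha0).mpr ha)).symm

theorem exists_lowPoly_eq {n : ℕ} {a : ℝ[X]} (ha : a.degree < (n / 2 + 1 : ℕ)) :
    ∃ v, lowPoly n v = a ∧ highPoly n v = 0 := by
  refine ⟨fun i => if (i : ℕ) < n / 2 + 1 then a.coeff i else 0, ?_, ?_⟩
  · rw [lowPoly, Fin.sum_univ_split (fun i => if i < n / 2 + 1 then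
      C (if i < n / 2 + 1 then a.coeff i else 0) * X ^ i else 0) (by omega : n / 2 + 1 ≤ n + 1)]
    conv_rhs => rw [← sum_range_C_mul_X_pow_of_degree_lt ha, ← add_zero (Finset.sum _ _)]
    congr 1
    · exact Finset.sum_congr rfl fun i hi => by simp [Finset.mem_range.mp hi]
    · exact Finset.sum_eq_zero fun i _ => if_neg (by omega)
  · exact Finset.sum_eq_zero fun i _ => by
      by_cases h : (i : ℕ) < n / 2 + 1 <;> simp only [h, if_true, if_false, C_0, zero_mul]

theorem exists_highPoly_eq {n : ℕ} {b : ℝ[X]} (hb : b.degree < (n + 1 - (n / 2 + 1) : ℕ)) :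
    ∃ v, lowPoly n v = 0 ∧ highPoly n v = b := by
  refine ⟨fun i => if (i : ℕ) < n / 2 + 1 then 0 else b.coeff (i - (n / 2 + 1)), ?_, ?_⟩
  · exact Finset.sum_eq_zero fun i _ => by
      by_cases h : (i : ℕ) < n / 2 + 1 <;> simp only [h, if_true, if_false, C_0, zero_mul]
  · rw [highPoly, Fin.sum_univ_split (fun i => if i < n / 2 + 1 then 0 else
      C (if i < n / 2 + 1 then 0 else b.coeff (i - (n / 2 + 1))) * X ^ (i - (n / 2 + 1)))
      (by omega : n / 2 + 1 ≤ n + 1)]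
    conv_rhs => rw [← sum_range_C_mul_X_pow_of_degree_lt hb, ← zero_add (Finset.sum _ _)]
    congr 1
    · exact Finset.sum_eq_zero fun i hi => if_pos (Finset.mem_range.mp hi)
    · refine Finset.sum_congr rfl fun i _ => ?_
      have h : ¬ n / 2 + 1 + i < n / 2 + 1 := by omega
      rw [if_neg h, if_neg h, Nat.add_sub_cancel_left]

theorem exists_dotProduct_B1D_mulVec_eq {n : ℕ} {s : ℝ[X]} (hs : s ∈ lukacsSquares n) :
    ∃ v, ∀ t, v ⬝ᵥ B1D n t *ᵥ v = s.eval t := by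
  rcases hs with ⟨a, ha, rfl⟩ | ⟨b, hb, rfl⟩
  · obtain ⟨v, h1, h2⟩ := exists_lowPoly_eq ha
    exact ⟨v, fun t => by simp [dotProduct_B1D_mulVec, h1, h2]⟩
  · obtain ⟨v, h1, h2⟩ := exists_highPoly_eq hb
    exact ⟨v, fun t => by simp [dotProduct_B1D_mulVec, h1, h2]⟩

theorem degree_lt_of_mem_lukacsSquares {n : ℕ} {s : ℝ[X]} (hs : s ∈ lukacsSquares n) :
    s.degree < (n + 1 : ℕ) := by
  have sq_lt : ∀ {a : ℝ[X]} {k d m : ℕ} {w : ℝ[X]}, a.degree < k → w.degree ≤ d →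
      2 * k + d ≤ m + 1 → (w * a ^ 2).degree < m := by
    intro a k d m w ha hw h
    rcases eq_or_ne a 0 with rfl | ha0
    · simp [bot_lt_iff_ne_bot]
    rw [degree_eq_natDegree ha0, Nat.cast_lt] at ha
    have h1 := natDegree_le_of_degree_le hw
    have h2 : (w * a ^ 2).natDegree ≤ w.natDegree + (a ^ 2).natDegree := natDegree_mul_le
    rw [natDegree_pow] at h2
    exact degree_le_natDegree.trans_lt (by exact_mod_cast (by omega))
  have hX : (1 - X : ℝ[X]).degree ≤ (1 : ℕ) := (degree_sub_le _ _).trans (by simp)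
  rcases Nat.mod_two_eq_zero_or_one n with h | h <;> rcases hs with ⟨a, ha, rfl⟩ | ⟨a, ha, rfl⟩
  · exact sq_lt (d := 0) ha (by simp [lukacsWeightLow, h]) (by omega)
  · refine sq_lt (d := 2) ha ?_ (by omega)
    simp only [lukacsWeightHigh, h, zero_ne_one, if_false]
    exact (degree_mul_le _ _).trans (add_le_add degree_X_le hX)
  · exact sq_lt (d := 1) ha (by simp [lukacsWeightLow, h]) (by omega)
  · exact sq_lt (d := 1) ha (by simpa [lukacsWeightHigh, h] using hX) (by omega)

end LocalizingMatrix

section Dual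

open Polynomial Filter Topology

variable {n : ℕ} {x : Fin (n + 1) → ℝ}

theorem dotProduct_M1D_mulVec (lam v : Fin (n + 1) → ℝ) :
    v ⬝ᵥ M1D n x lam *ᵥ v = v ⬝ᵥ v + ∑ r, lam r * (v ⬝ᵥ B1D n (x r) *ᵥ v) := by
  simp only [M1D, add_mulVec, one_mulVec, dotProduct_add, sum_mulVec, dotProduct_sum, smul_mulVec,
    dotProduct_smul, smul_eq_mul]

theorem M1D_posDef_iff {lam : Fin (n + 1) → ℝ} :
    (M1D n x lam).PosDef ↔ ∀ v, v ≠ 0 → 0 < v ⬝ᵥ M1D n x lam *ᵥ v := by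
  refine ⟨fun h v hv => h.dotProduct_mulVec_pos hv, fun h => .of_dotProduct_mulVec_pos ?_ ?_⟩
  · rw [IsHermitian, conjTranspose_eq_transpose_of_trivial, M1D]
    simp [transpose_sum, isSymm_B1D]
  · exact fun {v} hv => h v hv

theorem M1D_zero : M1D n x 0 = 1 := by simp [M1D]

/-- The moment functional of a point of the dual domain is bounded below at every element of the
cone of weighted squares. -/
theorem exists_neg_le_sum_of_mem_lukacsCone (x : Fin (n + 1) → ℝ) {f : ℝ[X]}
    (hf : f ∈ lukacsCone n) :
    ∃ c : ℝ, ∀ lam : Fin (n + 1) → ℝ, (M1D n x lam).PosDef →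
      -c ≤ ∑ r, f.eval (x r) * lam r := by
  induction hf using AddSubmonoid.closure_induction with
  | mem s hs =>
    obtain ⟨v, hv⟩ := exists_dotProduct_B1D_mulVec_eq hs
    refine ⟨v ⬝ᵥ v, fun lam h => ?_⟩
    have := h.posSemidef.dotProduct_mulVec_nonneg v
    rw [star_trivial, dotProduct_M1D_mulVec] at this
    simp only [hv, mul_comm (lam _)] at this
    linarith
  | zero => exact ⟨0, fun lam _ => by simp⟩
  | add f g _ _ hf hg =>
    obtain ⟨c, hc⟩ := hf
    obtain ⟨d, hd⟩ := hg
    refine ⟨c + d, fun lam h => ?_⟩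
    simp only [eval_add, add_mul, Finset.sum_add_distrib]
    linarith [hc lam h, hd lam h]

theorem exists_pos_eval_add_smul {p : ℝ[X]} (hp : ∀ t ∈ Set.Icc (0 : ℝ) 1, 0 < p.eval t)
    (q : ℝ[X]) :
    ∃ ε > 0, ∀ t ∈ Set.Icc (0 : ℝ) 1, 0 < (p + C ε * q).eval t ∧ 0 < (p - C ε * q).eval t := by
  have hI : (Set.Icc (0 : ℝ) 1).Nonempty := ⟨0, by simp⟩
  obtain ⟨a, ha, hamin⟩ := isCompact_Icc.exists_isMinOn hI p.continuous.continuousOn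
  obtain ⟨b, hb, hbmax⟩ := isCompact_Icc.exists_isMaxOn hI q.continuous.abs.continuousOn
  have hK : 0 < |q.eval b| + 1 := by positivity
  refine ⟨p.eval a / (|q.eval b| + 1), div_pos (hp a ha) hK, fun t ht => ?_⟩
  have h1 : p.eval a ≤ p.eval t := hamin ht
  have h2 : |q.eval t| ≤ |q.eval b| := hbmax ht
  have h3 : |p.eval a / (|q.eval b| + 1) * q.eval t| < p.eval a := by
    rw [abs_mul, abs_of_pos (div_pos (hp a ha) hK), div_mul_eq_mul_div, div_lt_iff₀ hK]
    exact mul_lt_mul_of_pos_left (by linarith) (hp a ha)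
  rw [abs_lt] at h3
  simp only [eval_add, eval_sub, eval_mul, eval_C]
  constructor <;> linarith [h3.1, h3.2]

/-- Each coordinate is controlled by the linear part of the dual function. -/
theorem exists_abs_le (hinj : Function.Injective x) {p : ℝ[X]} (hdeg : p.natDegree ≤ n)
    (hp : ∀ t ∈ Set.Icc (0 : ℝ) 1, 0 < p.eval t) (r : Fin (n + 1)) :
    ∃ a b : ℝ, 0 < a ∧ ∀ lam : Fin (n + 1) → ℝ, (M1D n x lam).PosDef →
      |lam r| ≤ a * (∑ s, p.eval (x s) * lam s) + b := by
  set q := Lagrange.basis Finset.univ x r with hq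
  have hqdeg : q.natDegree ≤ n := by
    rw [hq, Lagrange.natDegree_basis hinj.injOn (Finset.mem_univ r)]
    simp
  have hqeval : ∀ lam : Fin (n + 1) → ℝ, ∑ s, q.eval (x s) * lam s = lam r := by
    intro lam
    rw [Finset.sum_eq_single r]
    · rw [hq, Lagrange.eval_basis_self hinj.injOn (Finset.mem_univ r), one_mul]
    · intro s _ hs
      rw [hq, Lagrange.eval_basis_of_ne hs.symm (Finset.mem_univ s), zero_mul]
    · simp
  obtain ⟨ε, hε, hpos⟩ := exists_pos_eval_add_smul hp q
  have hCq : (C ε * q).natDegree ≤ n := (natDegree_C_mul_le _ _).trans hqdeg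
  obtain ⟨c, hc⟩ := exists_neg_le_sum_of_mem_lukacsCone x (mem_lukacsCone_of_pos n (p + C ε * q)
    (natDegree_add_le_of_degree_le hdeg hCq) fun t ht => (hpos t ht).1)
  obtain ⟨d, hd⟩ := exists_neg_le_sum_of_mem_lukacsCone x (mem_lukacsCone_of_pos n (p - C ε * q)
    (natDegree_sub_le_of_le hdeg hCq |>.trans (max_self n).le) fun t ht => (hpos t ht).2)
  refine ⟨ε⁻¹, ε⁻¹ * max c d, inv_pos.mpr hε, fun lam h => ?_⟩
  have h1 := hc lam h
  have h2 := hd lam h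
  simp only [eval_add, eval_sub, eval_mul, eval_C, add_mul, sub_mul, Finset.sum_add_distrib,
    Finset.sum_sub_distrib, mul_assoc, ← Finset.mul_sum, hqeval] at h1 h2
  rw [← mul_add, ← div_eq_inv_mul, le_div_iff₀ hε, ← abs_of_pos hε, ← abs_mul, abs_le]
  constructor <;> linarith [le_max_left c d, le_max_right c d, mul_comm (lam r) ε]

theorem exists_norm_le (hinj : Function.Injective x) {p : ℝ[X]} (hdeg : p.natDegree ≤ n)
    (hp : ∀ t ∈ Set.Icc (0 : ℝ) 1, 0 < p.eval t) :
    ∃ a b : ℝ, 0 < a ∧ ∀ lam : EuclideanSpace ℝ (Fin (n + 1)), (M1D n x lam).PosDef →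
      ‖lam‖ ≤ a * (∑ s, p.eval (x s) * lam s) + b := by
  choose a b ha h using exists_abs_le hinj hdeg hp
  refine ⟨∑ r, a r, ∑ r, b r, Finset.sum_pos (fun r _ => ha r) Finset.univ_nonempty,
    fun lam hlam => ?_⟩
  calc ‖lam‖ = ‖∑ r, lam r • EuclideanSpace.basisFun (Fin (n + 1)) ℝ r‖ := by
        conv_lhs => rw [← (EuclideanSpace.basisFun (Fin (n + 1)) ℝ).sum_repr lam]
        simp
    _ ≤ ∑ r, |lam r| := by
        refine (norm_sum_le _ _).trans (Finset.sum_le_sum fun r _ => ?_)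
        rw [norm_smul, OrthonormalBasis.norm_eq_one, mul_one, Real.norm_eq_abs]
    _ ≤ ∑ r, (a r * (∑ s, p.eval (x s) * lam s) + b r) :=
        Finset.sum_le_sum fun r _ => h r lam hlam
    _ = _ := by rw [Finset.sum_add_distrib, ← Finset.sum_mul]

theorem sum_smul_B1D_injective (hinj : Function.Injective x) {v : EuclideanSpace ℝ (Fin (n + 1))}
    (hv : ∑ r, v r • B1D n (x r) = 0) : v = 0 := by
  obtain ⟨a, b, ha, h⟩ := exists_norm_le hinj (p := 1) (by simp) (by simp)
  have hpd : ∀ s : ℝ, (M1D n x (s • v)).PosDef := fun s => by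
    have : M1D n x (s • v) = 1 := by
      simp only [M1D, Pi.smul_apply, smul_assoc, ← Finset.smul_sum]
      simp [hv]
    rw [this]
    exact PosDef.one
  by_contra hne
  have hnorm : 0 < ‖v‖ := norm_pos_iff.mpr hne
  set s := (|b| + 1) / ‖v‖
  have hs : 0 < s := by positivity
  have h1 := h (s • v) (hpd s)
  have h2 := h ((-s) • v) (hpd (-s))
  simp only [norm_smul, norm_neg, Real.norm_eq_abs, abs_of_pos hs, PiLp.smul_apply,
    smul_eq_mul, neg_mul, mul_neg, Finset.sum_neg_distrib] at h1 h2
  have h3 : s * ‖v‖ = |b| + 1 := div_mul_cancel₀ _ hnorm.ne'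
  linarith [le_abs_self b]

theorem M1D_injective (hinj : Function.Injective x) {lam mu : EuclideanSpace ℝ (Fin (n + 1))}
    (h : M1D n x lam = M1D n x mu) : lam = mu := by
  rw [← sub_eq_zero]
  refine sum_smul_B1D_injective hinj ?_
  simpa [M1D, sub_smul, sub_eq_zero] using h

end Dual

section Derivative

open Polynomial Filter Topology

attribute [local instance] Matrix.linftyOpNormedRing Matrix.linftyOpNormedAlgebra

theorem Matrix.exists_hasFDerivAt_trace_inv {ι : Type*} [Fintype ι] [DecidableEq ι]
    {A : Matrix ι ι ℝ} (hA : IsUnit A) :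
    ∃ L : Matrix ι ι ℝ →L[ℝ] ℝ, HasFDerivAt (fun B : Matrix ι ι ℝ => B⁻¹.trace) L A ∧
      ∀ H, L H = -(A⁻¹ * H * A⁻¹).trace := by
  have : CompleteSpace (Matrix ι ι ℝ) := FiniteDimensional.complete ℝ _
  obtain ⟨u, rfl⟩ := hA
  have h := (LinearMap.toContinuousLinearMap (traceLinearMap ι ℝ ℝ)).hasFDerivAt.comp _
    (hasFDerivAt_ringInverse (𝕜 := ℝ) u)
  refine ⟨_, h.congr_of_eventuallyEq (Eventually.of_forall fun B => ?_), fun H => ?_⟩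
  · exact congrArg trace (nonsing_inv_eq_ringInverse B)
  · rw [← coe_units_inv, ← trace_neg]
    rfl

variable {n : ℕ} {x : Fin (n + 1) → ℝ} {p : ℝ[X]}

theorem hasFDerivAt_M1D (lam : EuclideanSpace ℝ (Fin (n + 1))) :
    HasFDerivAt (fun mu : EuclideanSpace ℝ (Fin (n + 1)) => M1D n x mu)
      (∑ r, (EuclideanSpace.proj r : EuclideanSpace ℝ (Fin (n + 1)) →L[ℝ] ℝ).smulRight
        (B1D n (x r))) lam := by
  refine (HasFDerivAt.fun_sum fun r _ => ?_).const_add 1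
  exact ((EuclideanSpace.proj r :
    EuclideanSpace ℝ (Fin (n + 1)) →L[ℝ] ℝ).smulRight (B1D n (x r))).hasFDerivAt

theorem continuous_M1D :
    Continuous (fun mu : EuclideanSpace ℝ (Fin (n + 1)) => M1D n x mu) :=
  continuous_iff_continuousAt.mpr fun lam => (hasFDerivAt_M1D lam).continuousAt

theorem exists_hasFDerivAt_G1D {lam : EuclideanSpace ℝ (Fin (n + 1))}
    (hlam : (M1D n x lam).PosDef) :
    ∃ L : EuclideanSpace ℝ (Fin (n + 1)) →L[ℝ] ℝ, HasFDerivAt (G1D n x p) L lam ∧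
      ∀ v, L v = -((M1D n x lam)⁻¹ * (∑ r, v r • B1D n (x r)) * (M1D n x lam)⁻¹).trace +
        ∑ r, p.eval (x r) * v r := by
  obtain ⟨L, hL, hL_apply⟩ := exists_hasFDerivAt_trace_inv hlam.isUnit
  have h1 := hL.comp lam (hasFDerivAt_M1D (x := x) lam)
  have h2 := (∑ r, (p.eval (x r)) •
    (EuclideanSpace.proj r : EuclideanSpace ℝ (Fin (n + 1)) →L[ℝ] ℝ)).hasFDerivAt (x := lam)
  refine ⟨_, (h1.add h2).congr_of_eventuallyEq (Eventually.of_forall fun mu => ?_), fun v => ?_⟩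
  · simp [G1D]
  · refine congrArg₂ (· + ·) ((congrArg L ?_).trans (hL_apply _)) ?_
    · have hsum (f : Fin (n + 1) → EuclideanSpace ℝ (Fin (n + 1)) →L[ℝ]
          Matrix (Fin (n + 1)) (Fin (n + 1)) ℝ) : (∑ r, f r) v = ∑ r, f r v := by simp
      exact hsum _
    · simp

end Derivative

section Dual

open Polynomial Filter Topology

variable {n : ℕ} {x : Fin (n + 1) → ℝ} {p : ℝ[X]}

theorem differentiableAt_G1D {lam : EuclideanSpace ℝ (Fin (n + 1))}
    (hlam : (M1D n x lam).PosDef) : DifferentiableAt ℝ (G1D n x p) lam :=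
  (exists_hasFDerivAt_G1D hlam).choose_spec.1.differentiableAt

theorem fderiv_G1D_apply {lam : EuclideanSpace ℝ (Fin (n + 1))} (hlam : (M1D n x lam).PosDef)
    (v : EuclideanSpace ℝ (Fin (n + 1))) :
    fderiv ℝ (G1D n x p) lam v =
      -((M1D n x lam)⁻¹ * (∑ r, v r • B1D n (x r)) * (M1D n x lam)⁻¹).trace +
        ∑ r, p.eval (x r) * v r := by
  obtain ⟨L, hL, hLv⟩ := exists_hasFDerivAt_G1D (p := p) hlam
  rw [hL.fderiv, hLv]

/-- The dual function lies strictly above its tangents. -/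
theorem G1D_add_fderiv_lt (hinj : Function.Injective x) {lam mu : EuclideanSpace ℝ (Fin (n + 1))}
    (hlam : (M1D n x lam).PosDef) (hmu : (M1D n x mu).PosDef) (hne : lam ≠ mu) :
    G1D n x p lam + fderiv ℝ (G1D n x p) lam (mu - lam) < G1D n x p mu := by
  have h := hlam.trace_inv_sub_lt hmu fun h => hne (M1D_injective hinj h)
  have hsub : M1D n x mu - M1D n x lam = ∑ r, (mu - lam) r • B1D n (x r) := by
    simp [M1D, sub_smul]
  rw [hsub] at h
  rw [fderiv_G1D_apply hlam]
  simp only [G1D, PiLp.sub_apply, mul_sub, Finset.sum_sub_distrib] at h ⊢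
  linarith

theorem convex_M1D_posDef (n : ℕ) (x : Fin (n + 1) → ℝ) :
    Convex ℝ {lam : EuclideanSpace ℝ (Fin (n + 1)) | (M1D n x lam).PosDef} := by
  refine convex_iff_forall_pos.mpr fun lam hlam mu hmu a b ha hb hab => ?_
  have h : M1D n x (a • lam + b • mu) = a • M1D n x lam + b • M1D n x mu := by
    simp only [M1D, Pi.add_apply, Pi.smul_apply, smul_eq_mul, add_smul, mul_smul,
      Finset.sum_add_distrib, ← Finset.smul_sum, smul_add]
    rw [add_add_add_comm, ← add_smul, hab, one_smul]
  change (M1D n x (a • lam + b • mu)).PosDef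
  rw [h]
  exact (PosDef.smul hlam ha).add (PosDef.smul hmu hb)

theorem strictConvexOn_G1D (hinj : Function.Injective x) (p : ℝ[X]) :
    StrictConvexOn ℝ {lam : EuclideanSpace ℝ (Fin (n + 1)) | (M1D n x lam).PosDef}
      (G1D n x p) := by
  refine ⟨convex_M1D_posDef n x, fun lam hlam mu hmu hne a b ha hb hab => ?_⟩
  have hnu := convex_M1D_posDef n x hlam hmu ha.le hb.le hab
  set nu := a • lam + b • mu with hnu_def
  have e1 : lam - nu = b • (lam - mu) := by
    rw [hnu_def, eq_sub_of_add_eq hab]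
    module
  have e2 : mu - nu = (-a) • (lam - mu) := by
    rw [hnu_def, eq_sub_of_add_eq' hab]
    module
  have n1 : nu ≠ lam := by
    intro h
    rw [h, sub_self, eq_comm, smul_eq_zero, sub_eq_zero] at e1
    exact e1.elim hb.ne' hne
  have n2 : nu ≠ mu := by
    intro h
    rw [h, sub_self, eq_comm, smul_eq_zero, sub_eq_zero] at e2
    exact e2.elim (neg_ne_zero.mpr ha.ne') hne
  have h1 := mul_lt_mul_of_pos_left (G1D_add_fderiv_lt (p := p) hinj hnu hlam n1) ha
  have h2 := mul_lt_mul_of_pos_left (G1D_add_fderiv_lt (p := p) hinj hnu hmu n2) hb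
  rw [e1, map_smul, smul_eq_mul] at h1
  rw [e2, map_smul, smul_eq_mul] at h2
  have h3 : a * G1D n x p nu + b * G1D n x p nu = G1D n x p nu := by rw [← add_mul, hab, one_mul]
  simp only [smul_eq_mul]
  linarith

theorem eventually_M1D_posDef {lam : EuclideanSpace ℝ (Fin (n + 1))}
    (hlam : (M1D n x lam).PosDef) :
    ∀ᶠ mu : EuclideanSpace ℝ (Fin (n + 1)) in 𝓝 lam, (M1D n x mu).PosDef := by
  set c := (M1D n x lam)⁻¹.trace + 1
  have hc : 0 < c := by linarith [hlam.inv.posSemidef.trace_nonneg]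
  have hcont : Continuous fun mu : EuclideanSpace ℝ (Fin (n + 1)) =>
      ∑ i, ∑ j, |(M1D n x mu - M1D n x lam) i j| :=
    continuous_finsetSum _ fun i _ => continuous_finsetSum _ fun j _ =>
      ((continuous_M1D.sub continuous_const).matrix_elem i j).abs
  have hev := (hcont.continuousAt (x := lam)).eventually_lt
    (continuousAt_const (y := c⁻¹)) (by simpa using hc)
  filter_upwards [hev] with mu hmu
  refine M1D_posDef_iff.mpr fun v hv => ?_
  have hvv : 0 < v ⬝ᵥ v := by simpa using dotProduct_star_self_pos_iff.mpr hv
  have h1 := hlam.dotProduct_self_le hc (by simp [c]) v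
  have h2 := (abs_le.mp (abs_dotProduct_mulVec_le (M1D n x mu - M1D n x lam) v)).1
  have h3 := mul_lt_mul_of_pos_right hmu hvv
  rw [sub_mulVec, dotProduct_sub] at h2
  rw [← inv_mul_le_iff₀ hc] at h1
  linarith

theorem exists_isMinOn_G1D (hinj : Function.Injective x) (hdeg : p.natDegree ≤ n)
    (hp : ∀ t ∈ Set.Icc (0 : ℝ) 1, 0 < p.eval t) :
    ∃ lam : EuclideanSpace ℝ (Fin (n + 1)), (M1D n x lam).PosDef ∧
      ∀ mu : EuclideanSpace ℝ (Fin (n + 1)), (M1D n x mu).PosDef →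
        G1D n x p lam ≤ G1D n x p mu := by
  obtain ⟨a, b, ha, hab⟩ := exists_norm_le hinj hdeg hp
  set g := G1D n x p 0
  set c := max 1 (g + b / a)
  set R := max 0 (a * g + b)
  have hc : 0 < c := zero_lt_one.trans_le (le_max_left _ _)
  set K : Set (EuclideanSpace ℝ (Fin (n + 1))) :=
    Metric.closedBall 0 R ∩ {lam | ∀ v, v ⬝ᵥ v ≤ c * (v ⬝ᵥ M1D n x lam *ᵥ v)}
  have hKpos : ∀ lam ∈ K, (M1D n x lam).PosDef := fun lam h =>
    M1D_posDef_iff.mpr fun v hv => by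
      have hvv : 0 < v ⬝ᵥ v := by simpa using dotProduct_star_self_pos_iff.mpr hv
      exact pos_of_mul_pos_right (hvv.trans_le (h.2 v)) hc.le
  have hKcompact : IsCompact K := by
    refine (isCompact_closedBall _ _).inter_right ?_
    rw [Set.ofPred_forall]
    refine isClosed_iInter fun v => isClosed_le continuous_const (continuous_const.mul ?_)
    exact continuous_const.dotProduct (continuous_M1D.matrix_mulVec continuous_const)
  have h0 : (0 : EuclideanSpace ℝ (Fin (n + 1))) ∈ K := by
    refine ⟨by simp [R], fun v => ?_⟩
    have hvv : 0 ≤ v ⬝ᵥ v := Finset.sum_nonneg fun i _ => mul_self_nonneg _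
    rw [WithLp.ofLp_zero, M1D_zero, one_mulVec]
    exact le_mul_of_one_le_left hvv (le_max_left _ _)
  obtain ⟨lam, hlam, hmin⟩ := hKcompact.exists_isMinOn ⟨0, h0⟩
    (f := G1D n x p) fun mu hmu =>
      (differentiableAt_G1D (hKpos mu hmu)).continuousAt.continuousWithinAt
  refine ⟨lam, hKpos lam hlam, fun mu hmu => ?_⟩
  rcases le_or_gt (G1D n x p mu) g with h | h
  · refine hmin ⟨?_, ?_⟩
    · have h1 := hab mu hmu
      have h2 := hmu.inv.posSemidef.trace_nonneg
      have h3 : ∑ s, p.eval (x s) * mu s ≤ g := by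
        simp only [G1D] at h
        linarith
      rw [mem_closedBall_zero_iff]
      exact (h1.trans (by gcongr)).trans (le_max_right _ _)
    · refine hmu.dotProduct_self_le hc (le_trans ?_ (le_max_right _ _))
      have h1 := (norm_nonneg _).trans (hab mu hmu)
      have h2 : -(b / a) ≤ ∑ s, p.eval (x s) * mu s := by
        rw [← neg_div, div_le_iff₀ ha]
        linarith
      simp only [G1D] at h
      linarith
  · exact (hmin h0).trans h.le

theorem G1D_coercive (hinj : Function.Injective x) (hdeg : p.natDegree ≤ n)
    (hp : ∀ t ∈ Set.Icc (0 : ℝ) 1, 0 < p.eval t) (A : ℝ) :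
    ∃ R : ℝ, ∀ lam : EuclideanSpace ℝ (Fin (n + 1)),
      (M1D n x lam).PosDef → R ≤ ‖lam‖ → A ≤ G1D n x p lam := by
  obtain ⟨a, b, ha, hab⟩ := exists_norm_le hinj hdeg hp
  refine ⟨a * A + b, fun lam hlam hR => ?_⟩
  have h1 := hR.trans (hab lam hlam)
  have h2 := le_of_mul_le_mul_left (by linarith : a * A ≤ a * _) ha
  rw [G1D]
  linarith [hlam.inv.posSemidef.trace_nonneg]

theorem existsUnique_critical_G1D (hinj : Function.Injective x) (hdeg : p.natDegree ≤ n)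
    (hp : ∀ t ∈ Set.Icc (0 : ℝ) 1, 0 < p.eval t) :
    ∃! lam : EuclideanSpace ℝ (Fin (n + 1)),
      (M1D n x lam).PosDef ∧ fderiv ℝ (G1D n x p) lam = 0 := by
  obtain ⟨lam, hlam, hmin⟩ := exists_isMinOn_G1D hinj hdeg hp
  have hcrit : fderiv ℝ (G1D n x p) lam = 0 :=
    IsLocalMin.fderiv_eq_zero ((eventually_M1D_posDef hlam).mono fun mu hmu => hmin mu hmu)
  refine ⟨lam, ⟨hlam, hcrit⟩, fun mu ⟨hmu, hmu0⟩ => ?_⟩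
  by_contra hne
  have := G1D_add_fderiv_lt (p := p) hinj hmu hlam hne
  rw [hmu0, _root_.zero_apply, add_zero] at this
  exact absurd (hmin mu hmu) this.not_ge

/-- A critical point of the dual function gives a weighted sum-of-squares decomposition, with
squares built from the columns of `M(λ)⁻¹`. -/
theorem eq_weighted_sum_of_fderiv_eq_zero (hinj : Function.Injective x) (hdeg : p.natDegree ≤ n)
    {lam : EuclideanSpace ℝ (Fin (n + 1))} (hlam : (M1D n x lam).PosDef)
    (hcrit : fderiv ℝ (G1D n x p) lam = 0) :
    p = lukacsWeightLow n * ∑ i, lowPoly n ((M1D n x lam)⁻¹.col i) ^ 2 +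
      lukacsWeightHigh n * ∑ i, highPoly n ((M1D n x lam)⁻¹.col i) ^ 2 := by
  rw [Finset.mul_sum, Finset.mul_sum]
  refine eq_of_degrees_lt_of_eval_index_eq (v := x) Finset.univ hinj.injOn ?_ ?_ ?_
  · rw [Finset.card_univ, Fintype.card_fin]
    exact degree_le_natDegree.trans_lt (by exact_mod_cast (by omega))
  · rw [Finset.card_univ, Fintype.card_fin, ← mem_degreeLT]
    refine add_mem (sum_mem fun i _ => ?_) (sum_mem fun i _ => ?_)
    · exact mem_degreeLT.mpr (degree_lt_of_mem_lukacsSquares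
        (Or.inl ⟨_, degree_lowPoly_lt n _, rfl⟩))
    · exact mem_degreeLT.mpr (degree_lt_of_mem_lukacsSquares
        (Or.inr ⟨_, degree_highPoly_lt n _, rfl⟩))
  · intro r _
    have h := fderiv_G1D_apply (p := p) hlam (EuclideanSpace.single r 1)
    rw [hcrit] at h
    nth_rw 1 [← hlam.transpose_inv_eq] at h
    simp only [_root_.zero_apply, PiLp.single_apply, ite_smul, one_smul, zero_smul,
      Finset.sum_ite_eq', Finset.mem_univ, if_true, mul_ite, mul_one, mul_zero,
      trace_transpose_mul_mul, dotProduct_B1D_mulVec] at h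
    rw [← Finset.sum_add_distrib, eval_finsetSum]
    linarith

end Dual

theorem univariate_main_theorem
    (n : ℕ) (p : Polynomial ℝ) (hdeg : p.natDegree ≤ n)
    (hp : ∀ t ∈ Set.Icc (0 : ℝ) 1, 0 < p.eval t)
    (x : Fin (n + 1) → ℝ)
    (hinj : Function.Injective x)
    (hmem : ∀ r, x r ∈ Set.Icc (0 : ℝ) 1) :
    StrictConvexOn ℝ
      {lam : EuclideanSpace ℝ (Fin (n + 1)) | (M1D n x lam).PosDef}
      (G1D n x p) ∧
    (∀ A : ℝ, ∃ R : ℝ, ∀ lam : EuclideanSpace ℝ (Fin (n + 1)),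
        (M1D n x lam).PosDef → R ≤ ‖lam‖ → A ≤ G1D n x p lam) ∧
    (∃! lam : EuclideanSpace ℝ (Fin (n + 1)),
        (M1D n x lam).PosDef ∧ fderiv ℝ (G1D n x p) lam = 0) ∧
    (∀ lam : EuclideanSpace ℝ (Fin (n + 1)),
        (M1D n x lam).PosDef → fderiv ℝ (G1D n x p) lam = 0 →
        ∃ a b : Fin (n + 1) → Polynomial ℝ,
          (∀ i, (a i).degree < (n / 2 + 1 : ℕ)) ∧
          (∀ i, (b i).degree < (n + 1 - (n / 2 + 1) : ℕ)) ∧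
          p = (if n % 2 = 1 then Polynomial.X else 1) * ∑ i, (a i) ^ 2 +
              (if n % 2 = 1 then 1 - Polynomial.X
                else Polynomial.X * (1 - Polynomial.X)) * ∑ i, (b i) ^ 2) := by
  refine ⟨strictConvexOn_G1D hinj p, G1D_coercive hinj hdeg hp,
    existsUnique_critical_G1D hinj hdeg hp, fun lam hlam hcrit => ?_⟩
  exact ⟨fun i => lowPoly n ((M1D n x lam)⁻¹.col i), fun i => highPoly n ((M1D n x lam)⁻¹.col i),
    fun i => degree_lowPoly_lt n _, fun i => degree_highPoly_lt n _,
    eq_weighted_sum_of_fderiv_eq_zero hinj hdeg hlam hcrit⟩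
end
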